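/- For all u, v, β ∈ ℂ and all a = (a₁,a₂,a₃,a₄) ∈ ℂ⁴ with a₁+a₂+a₃+a₄ = 0, the following theta identity holds: θ(2v)·{ e^{2πiβ}·θ(u+v+β+1/2+τ/2)·θ(u−v+β+1/2+τ/2)·∏_{i=1}^4 θ(u+a_i−β/2) − e^{−2πiβ}·θ(u+v−β+1/2+τ/2)·θ(u−v−β+1/2+τ/2)·∏_{i=1}^4 θ(u−a_i+β/2) } = e^{πi(τ−4v)}·θ(2u)·{ e^{−2πiβ}·θ(u+v−β+1/2+τ/2)·θ(u−v+β+1/2+τ/2)·∏_{i=1}^4 θ(v+a_i+1/2−τ/2+β/2) − e^{2πiβ}·θ(u+v+β+1/2+τ/2)·θ(u−v−β+1/2+τ/2)·∏_{i=1}^4 θ(v−a_i+1/2−τ/2−β/2) }. (The paper uses this with β = (N+2)η; it is the key identity in the proof that Δ(a)* = ∓σ∘Δ(∓ā)∘σ.) -/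

import Mathlib

noncomputable section
open Complex MeasureTheory

def cπ : ℂ := Real.pi

/-- Jacobi's first theta function θ₁(x|τ). -/
def θf (τ x : ℂ) : ℂ :=
  I * ∑' n : ℤ, (-1 : ℂ) ^ n *
    Complex.exp (cπ * I * τ * ((n : ℂ) - 1/2)^2 + cπ * I * (2*(n : ℂ) - 1) * x)

/-- The space Θ_N of even theta functions of order 2N. -/
def ThetaSp (τ : ℂ) (N : ℕ) (f : ℂ → ℂ) : Prop :=
  Differentiable ℂ f ∧ (∀ x, f (x + 1) = f x) ∧
  (∀ x, f (x + τ) = Complex.exp (-2*cπ*I*N*(2*x + τ)) * f x) ∧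
  (∀ x, f (-x) = f x)

/-- Sklyanin's weight function M(u,v). -/
def Mw (τ η : ℂ) (N : ℕ) (u v : ℂ) : ℂ :=
  θf τ (2*u) * θf τ (2*v) /
    (Complex.exp (2*cπ*I*u*(N+2)) *
      ∏ k ∈ Finset.range (N+2),
        (θf τ (u + v + (2*(k:ℂ) - N - 1)*η + 1/2 + τ/2) *
         θf τ (u - v + (2*(k:ℂ) - N - 1)*η + 1/2 + τ/2)))

/-- Sklyanin's invariant pairing, with τ = t * I. -/
def pairing (τ η : ℂ) (t : ℝ) (N : ℕ) (f g : ℂ → ℂ) : ℂ :=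
  ∫ y in (0:ℝ)..t, ∫ x in (0:ℝ)..(1:ℝ),
    f (x + y*I) * (starRingEnd ℂ) (g (x + y*I)) *
      Mw τ η N (x + y*I) ((starRingEnd ℂ) (x + y*I))

/-- The numerator defining the difference operator Δ(a). -/
def ΔRHS (τ η : ℂ) (N : ℕ) (a₁ a₂ a₃ a₄ : ℂ) (f : ℂ → ℂ) (x : ℂ) : ℂ :=
  θf τ (x + a₁ - N*η/2) * θf τ (x + a₂ - N*η/2) * θf τ (x + a₃ - N*η/2) *
    θf τ (x + a₄ - N*η/2) * f (x + η)
  - θf τ (x - a₁ + N*η/2) * θf τ (x - a₂ + N*η/2) * θf τ (x - a₃ + N*η/2) *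
    θf τ (x - a₄ + N*η/2) * f (x - η)

/-- The involution σ on Θ_N. -/
def σop (τ : ℂ) (N : ℕ) (f : ℂ → ℂ) (x : ℂ) : ℂ :=
  Complex.exp (2*cπ*I*N*(1/4 + τ/4 + x)) * f (x + 1/2 + τ/2)

/-- q-Pochhammer infinite product (a;p)_∞. -/
def qPoch (a p : ℂ) : ℂ := ∏' j : ℕ, (1 - a * p^j)

/-- The constant C of Theorem 3.2. -/
def Cconst (τ η : ℂ) (N : ℕ) : ℂ :=
  2*η * Complex.exp (2*cπ*I*τ*(3/8)) /
    (θf τ (2*(N+1)*η) *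
      (qPoch (Complex.exp (2*cπ*I*τ)) (Complex.exp (2*cπ*I*τ)))^3)

/-- The kernel K(u,w). -/
def Kk (τ η : ℂ) (N : ℕ) (u w : ℂ) : ℂ :=
  Complex.exp (2*cπ*I*u*(N:ℂ)) *
  ∏ k ∈ Finset.range N,
    (θf τ (u + w + (2*(k:ℂ) - N + 1)*η + 1/2 + τ/2) *
     θf τ (u - w + (2*(k:ℂ) - N + 1)*η + 1/2 + τ/2))

/-- The basis functions e_k^N(x;a,b). -/
def ekN (τ η : ℂ) (N k : ℕ) (a b : ℂ) (x : ℂ) : ℂ :=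
  (∏ j ∈ Finset.range k, (θf τ (a + x + 2*(j:ℂ)*η) * θf τ (a - x + 2*(j:ℂ)*η))) *
  (∏ j ∈ Finset.range (N - k), (θf τ (b + x + 2*(j:ℂ)*η) * θf τ (b - x + 2*(j:ℂ)*η)))

/-- Elliptic number [x] = θ(2ηx). -/
def ell (τ η x : ℂ) : ℂ := θf τ (2*η*x)

/-- Elliptic shifted factorial [x]_k. -/
def ellFac (τ η x : ℂ) (k : ℕ) : ℂ := ∏ j ∈ Finset.range k, ell τ η (x + j)




lemma θf_eq (τ x : ℂ) : θf τ x =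
    I * (Complex.exp (cπ * I * τ / 4 - cπ * I * x) * jacobiTheta₂ (x + 1/2 - τ/2) τ) := by
  unfold θf jacobiTheta₂
  congr 1
  refine Eq.trans ?_ tsum_mul_left
  refine tsum_congr fun n => ?_
  have h : (-1 : ℂ) ^ n = Complex.exp (cπ * I * n) := by
    unfold cπ
    rw [← Complex.exp_pi_mul_I, ← Complex.exp_int_mul]
    congr 1; ring
  rw [h, jacobiTheta₂_term, ← Complex.exp_add, ← Complex.exp_add]
  congr 1
  simp only [cπ]
  ring

lemma exp_two_cpi : Complex.exp (2 * cπ * I) = 1 := by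
  simp only [cπ]; exact Complex.exp_two_pi_mul_I

lemma exp_cpi : Complex.exp (cπ * I) = -1 := by
  simp only [cπ]; exact Complex.exp_pi_mul_I

lemma θf_add_one (τ x : ℂ) : θf τ (x + 1) = - θf τ x := by
  rw [θf_eq, θf_eq]
  rw [show x + 1 + 1/2 - τ/2 = (x + 1/2 - τ/2) + 1 by ring, jacobiTheta₂_add_left,
    show cπ * I * τ / 4 - cπ * I * (x + 1) = (cπ * I * τ / 4 - cπ * I * x) + cπ * I - 2 * cπ * I by ring,
    Complex.exp_sub, Complex.exp_add, exp_cpi, exp_two_cpi]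
  ring

lemma θf_add_tau (τ x : ℂ) :
    θf τ (x + τ) = - Complex.exp (-(cπ * I * τ) - 2 * cπ * I * x) * θf τ x := by
  rw [θf_eq, θf_eq]
  rw [show x + τ + 1/2 - τ/2 = (x + 1/2 - τ/2) + τ by ring, jacobiTheta₂_add_left']
  have h : Complex.exp (cπ * I * τ / 4 - cπ * I * (x + τ)) *
      Complex.exp (-(Real.pi : ℂ) * I * (τ + 2 * (x + 1/2 - τ/2))) =
      - (Complex.exp (-(cπ * I * τ) - 2 * cπ * I * x) * Complex.exp (cπ * I * τ / 4 - cπ * I * x)) := by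
    have e : Complex.exp (-(cπ * I)) = -1 := by rw [Complex.exp_neg, exp_cpi]; norm_num
    rw [← neg_one_mul (_ * Complex.exp _), ← e]
    simp only [← Complex.exp_add]
    congr 1
    simp only [cπ]
    ring
  linear_combination (I * jacobiTheta₂ (x + 1/2 - τ/2) τ) * h

lemma θf_neg (τ x : ℂ) : θf τ (-x) = - θf τ x := by
  have h1 := θf_add_one τ (x - 1)
  rw [sub_add_cancel] at h1
  rw [h1, neg_neg, θf_eq, θf_eq]
  rw [show -x + 1/2 - τ/2 = -((x - 1 + 1/2 - τ/2) + τ) by ring, jacobiTheta₂_neg_left,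
    jacobiTheta₂_add_left']
  have h : Complex.exp (cπ * I * τ / 4 - cπ * I * (-x)) *
      Complex.exp (-(Real.pi : ℂ) * I * (τ + 2 * (x - 1 + 1/2 - τ/2))) =
      Complex.exp (cπ * I * τ / 4 - cπ * I * (x - 1)) := by
    rw [← Complex.exp_add]
    congr 1
    simp only [cπ]
    ring
  linear_combination (I * jacobiTheta₂ (x - 1 + 1/2 - τ/2) τ) * h

lemma θf_diff (τ : ℂ) (hτ : 0 < τ.im) : Differentiable ℂ (θf τ) := by
  have h : θf τ = fun x => I * (Complex.exp (cπ * I * τ / 4 - cπ * I * x) *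
      jacobiTheta₂ (x + 1/2 - τ/2) τ) := funext (θf_eq τ)
  rw [h]
  intro x
  have h2 : DifferentiableAt ℂ (fun x : ℂ => jacobiTheta₂ (x + 1/2 - τ/2) τ) x :=
    (differentiableAt_jacobiTheta₂_fst (x + 1/2 - τ/2) hτ).comp x
      (f := fun x : ℂ => x + 1/2 - τ/2) (by fun_prop)
  fun_prop

def parMap : (ℤ × ℤ) ⊕ (ℤ × ℤ) → ℤ × ℤ :=
  Sum.elim (fun p => (p.1 + p.2 + 1, p.1 - p.2)) (fun p => (p.1 + p.2 + 1, p.1 - p.2 + 1))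

lemma parMap_bij : Function.Bijective parMap := by
  constructor
  · rintro (⟨a, b⟩ | ⟨a, b⟩) (⟨c, d⟩ | ⟨c, d⟩) h <;>
      simp [parMap] at h ⊢ <;> omega
  · rintro ⟨m, n⟩
    rcases Int.even_or_odd' (m - n) with ⟨l, h | h⟩
    · exact ⟨Sum.inr (m - 1 - l, l), by simp [parMap]; omega⟩
    · exact ⟨Sum.inl (m - 1 - l, l), by simp [parMap]; omega⟩

def Ef (τ x : ℂ) : ℂ := jacobiTheta₂ (2 * x) (2 * τ)
def Of (τ x : ℂ) : ℂ := Complex.exp (cπ * I * τ / 2 + 2 * cπ * I * x) *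
  jacobiTheta₂ (2 * x + τ) (2 * τ)

lemma hasSum_congr_pt {α : Type*} {f g : α → ℂ} {a : ℂ} (h : HasSum f a)
    (e : ∀ p, g p = f p) : HasSum g a := by
  rwa [show g = f from funext e]

lemma prod_tsum {τ₁ : ℂ} (h : 0 < τ₁.im) (x y : ℂ) :
    HasSum (fun p : ℤ × ℤ => jacobiTheta₂_term p.1 x τ₁ * jacobiTheta₂_term p.2 y τ₁)
      (jacobiTheta₂ x τ₁ * jacobiTheta₂ y τ₁) := by
  have h1 := ((summable_jacobiTheta₂_term_iff x τ₁).2 h).norm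
  have h2 := ((summable_jacobiTheta₂_term_iff y τ₁).2 h).norm
  have h3 := summable_mul_of_summable_norm h1 h2
  have h4 := tsum_mul_tsum_of_summable_norm h1 h2
  rw [jacobiTheta₂, jacobiTheta₂, h4]
  exact h3.hasSum

lemma exp_cpi_two_int (n : ℤ) : Complex.exp (2 * cπ * I * n) = 1 := by
  rw [show 2 * cπ * I * n = n * (2 * Real.pi * I) by simp only [cπ]; ring]
  exact Complex.exp_int_mul_two_pi_mul_I n

lemma θf_mul (τ : ℂ) (hτ : 0 < τ.im) (x y : ℂ) :
    θf τ (x + y) * θf τ (x - y) = Ef τ x * Of τ y - Of τ x * Ef τ y := by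
  have h2 : 0 < (2 * τ).im := by simpa using hτ
  have H := prod_tsum hτ (x + y + 1/2 - τ/2) (x - y + 1/2 - τ/2)
  have H1 := prod_tsum h2 (2 * x) (2 * y + τ)
  have H2 := prod_tsum h2 (2 * x + τ) (2 * y)
  rw [← (Equiv.ofBijective _ parMap_bij).hasSum_iff] at H
  have H3 := HasSum.sum (f := fun p => Complex.exp (cπ * I * τ / 4 - cπ * I * (x + y)) *
      Complex.exp (cπ * I * τ / 4 - cπ * I * (x - y)) *
      (jacobiTheta₂_term (parMap p).1 (x + y + 1/2 - τ/2) τ *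
        jacobiTheta₂_term (parMap p).2 (x - y + 1/2 - τ/2) τ))
      (a := - Complex.exp (cπ * I * τ / 2 + 2 * cπ * I * y) *
        (jacobiTheta₂ (2 * x) (2 * τ) * jacobiTheta₂ (2 * y + τ) (2 * τ)))
      (b := Complex.exp (cπ * I * τ / 2 + 2 * cπ * I * x) *
        (jacobiTheta₂ (2 * x + τ) (2 * τ) * jacobiTheta₂ (2 * y) (2 * τ))) ?_ ?_
  · have H4 := (H.mul_left (Complex.exp (cπ * I * τ / 4 - cπ * I * (x + y)) *
      Complex.exp (cπ * I * τ / 4 - cπ * I * (x - y)))).unique H3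
    rw [θf_eq, θf_eq, Ef, Ef, Of, Of]
    linear_combination (-1) * H4 + (Complex.exp (cπ * I * τ / 4 - cπ * I * (x + y)) *
      Complex.exp (cπ * I * τ / 4 - cπ * I * (x - y)) *
      jacobiTheta₂ (x + y + 1/2 - τ/2) τ * jacobiTheta₂ (x - y + 1/2 - τ/2) τ) * I_sq
  · refine hasSum_congr_pt (H1.mul_left (- Complex.exp (cπ * I * τ / 2 + 2 * cπ * I * y))) fun p => ?_
    obtain ⟨k, l⟩ := p
    simp only [Function.comp, parMap, Sum.elim_inl, jacobiTheta₂_term]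
    have e : - Complex.exp (cπ * I * τ / 2 + 2 * cπ * I * y) =
        Complex.exp (cπ * I * τ / 2 + 2 * cπ * I * y + cπ * I + 2 * cπ * I * k) := by
      simp only [Complex.exp_add, exp_cpi, exp_cpi_two_int]; ring
    rw [e]
    simp only [← Complex.exp_add]
    congr 1
    simp only [cπ]
    push_cast
    ring
  · refine hasSum_congr_pt (H2.mul_left (Complex.exp (cπ * I * τ / 2 + 2 * cπ * I * x))) fun p => ?_
    obtain ⟨k, l⟩ := p
    simp only [Function.comp, parMap, Sum.elim_inr, jacobiTheta₂_term]
    have e : Complex.exp (cπ * I * τ / 2 + 2 * cπ * I * x) =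
        Complex.exp (cπ * I * τ / 2 + 2 * cπ * I * x + 2 * cπ * I * ((k + 1 : ℤ) : ℂ)) := by
      rw [Complex.exp_add _ (2 * cπ * I * ((k + 1 : ℤ) : ℂ)), exp_cpi_two_int]; ring
    rw [e]
    simp only [← Complex.exp_add]
    congr 1
    simp only [cπ]
    push_cast
    ring


lemma three_term (T E O : ℂ → ℂ) (odd : ∀ x, T (-x) = - T x)
    (hf : ∀ x y, T (x + y) * T (x - y) = E x * O y - O x * E y)
    (z₁ z₂ z₃ w₁ w₂ w₃ : ℂ) (h : z₁ + z₂ + z₃ = w₁ + w₂ + w₃) :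
    T (z₁ - w₁) * T (z₁ - w₂) * T (z₁ - w₃) * T (z₂ - z₃)
    - T (z₂ - w₁) * T (z₂ - w₂) * T (z₂ - w₃) * T (z₁ - z₃)
    + T (z₃ - w₁) * T (z₃ - w₂) * T (z₃ - w₃) * T (z₁ - z₂) = 0 := by
  have key : ∀ z, T (z - w₁) * T (z - w₂) =
      E (z - (w₁ + w₂)/2) * O ((w₁ - w₂)/2) - O (z - (w₁ + w₂)/2) * E ((w₁ - w₂)/2) := by
    intro z
    rw [← hf, mul_comm]
    congr 2 <;> ring
  have key2 : ∀ a b c, a + b + c = w₁ + w₂ + w₃ → T (c - w₃) * T (a - b) =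
      -(E (a - (w₁ + w₂)/2) * O (b - (w₁ + w₂)/2) - O (a - (w₁ + w₂)/2) * E (b - (w₁ + w₂)/2)) := by
    intro a b c habc
    rw [← hf, ← neg_mul, ← odd]
    congr 2
    · linear_combination habc
    · ring
  have a1 := key z₁
  have a2 := key z₂
  have a3 := key z₃
  have b1 := key2 z₂ z₃ z₁ (by linear_combination h)
  have b2 := key2 z₁ z₃ z₂ (by linear_combination h)
  have b3 := key2 z₁ z₂ z₃ (by linear_combination h)
  calc _ = (T (z₁ - w₁) * T (z₁ - w₂)) * (T (z₁ - w₃) * T (z₂ - z₃))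
    - (T (z₂ - w₁) * T (z₂ - w₂)) * (T (z₂ - w₃) * T (z₁ - z₃))
    + (T (z₃ - w₁) * T (z₃ - w₂)) * (T (z₃ - w₃) * T (z₁ - z₂)) := by ring
    _ = 0 := by rw [a1, a2, a3, b1, b2, b3]; ring

def G4 (T : ℂ → ℂ) (z₁ z₂ z₃ z₄ w₁ w₂ w₃ w₄ : ℂ) : ℂ :=
  (T (z₁ - w₁) * T (z₁ - w₂) * T (z₁ - w₃) * T (z₁ - w₄)) * (T (z₂ - z₃) * T (z₂ - z₄) * T (z₃ - z₄))
  - (T (z₂ - w₁) * T (z₂ - w₂) * T (z₂ - w₃) * T (z₂ - w₄)) * (T (z₁ - z₃) * T (z₁ - z₄) * T (z₃ - z₄))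
  + (T (z₃ - w₁) * T (z₃ - w₂) * T (z₃ - w₃) * T (z₃ - w₄)) * (T (z₁ - z₂) * T (z₁ - z₄) * T (z₂ - z₄))
  - (T (z₄ - w₁) * T (z₄ - w₂) * T (z₄ - w₃) * T (z₄ - w₄)) * (T (z₁ - z₂) * T (z₁ - z₃) * T (z₂ - z₃))

lemma four_term_mul (T E O : ℂ → ℂ) (odd : ∀ x, T (-x) = - T x)
    (hf : ∀ x y, T (x + y) * T (x - y) = E x * O y - O x * E y)
    (z₁ z₂ z₃ z₄ w₁ w₂ w₃ w₄ : ℂ) (h : z₁ + z₂ + z₃ + z₄ = w₁ + w₂ + w₃ + w₄) :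
    (T (z₃ + z₄ - w₁ - w₂) * T (z₃ - z₄)) * G4 T z₁ z₂ z₃ z₄ w₁ w₂ w₃ w₄ = 0 := by
  have key : ∀ z, T (z - w₁) * T (z - w₂) =
      E (z - (w₁ + w₂)/2) * O ((w₁ - w₂)/2) - O (z - (w₁ + w₂)/2) * E ((w₁ - w₂)/2) := by
    intro z
    rw [← hf, mul_comm]
    congr 2 <;> ring
  have key2 : ∀ a b, T (a - (w₁ + w₂ - b)) * T (a - b) =
      (E (a - (w₁ + w₂)/2) * O (b - (w₁ + w₂)/2) - O (a - (w₁ + w₂)/2) * E (b - (w₁ + w₂)/2)) := by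
    intro a b
    rw [← hf]
    congr 2 <;> ring
  have t4 := three_term T E O odd hf z₁ z₂ z₃ (w₁ + w₂ - z₄) w₃ w₄ (by linear_combination h)
  have t3 := three_term T E O odd hf z₁ z₂ z₄ (w₁ + w₂ - z₃) w₃ w₄ (by linear_combination h)
  have hH : T (z₃ + z₄ - w₁ - w₂) = T (z₃ - (w₁ + w₂ - z₄)) := by congr 1; ring
  have hH' : T (z₄ - (w₁ + w₂ - z₃)) = T (z₃ - (w₁ + w₂ - z₄)) := by congr 1; ring
  have a1 := key z₁
  have a2 := key z₂
  have a3 := key z₃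
  have a4 := key z₄
  have b13 := key2 z₁ z₃
  have b14 := key2 z₁ z₄
  have b23 := key2 z₂ z₃
  have b24 := key2 z₂ z₄
  have b34 := key2 z₃ z₄
  rw [hH]
  rw [hH'] at t3
  unfold G4
  generalize E (z₁ - (w₁ + w₂)/2) = e1 at *
  generalize E (z₂ - (w₁ + w₂)/2) = e2 at *
  generalize E (z₃ - (w₁ + w₂)/2) = e3 at *
  generalize E (z₄ - (w₁ + w₂)/2) = e4 at *
  generalize O (z₁ - (w₁ + w₂)/2) = o1 at *
  generalize O (z₂ - (w₁ + w₂)/2) = o2 at *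
  generalize O (z₃ - (w₁ + w₂)/2) = o3 at *
  generalize O (z₄ - (w₁ + w₂)/2) = o4 at *
  generalize E ((w₁ - w₂)/2) = ey at *
  generalize O ((w₁ - w₂)/2) = oy at *
  -- exchange relations
  have q1 : T (z₁ - w₁) * T (z₁ - w₂) * (T (z₃ - (w₁ + w₂ - z₄)) * T (z₃ - z₄)) =
      T (z₁ - (w₁ + w₂ - z₄)) * T (z₁ - z₄) * (e3 * oy - o3 * ey)
      - T (z₁ - (w₁ + w₂ - z₃)) * T (z₁ - z₃) * (e4 * oy - o4 * ey) := by
    rw [a1, b34, b14, b13]; ring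
  have q2 : T (z₂ - w₁) * T (z₂ - w₂) * (T (z₃ - (w₁ + w₂ - z₄)) * T (z₃ - z₄)) =
      T (z₂ - (w₁ + w₂ - z₄)) * T (z₂ - z₄) * (e3 * oy - o3 * ey)
      - T (z₂ - (w₁ + w₂ - z₃)) * T (z₂ - z₃) * (e4 * oy - o4 * ey) := by
    rw [a2, b34, b24, b23]; ring
  linear_combination (T (z₁ - w₃) * T (z₁ - w₄) * (T (z₂ - z₃) * T (z₂ - z₄) * T (z₃ - z₄))) * q1
    - (T (z₂ - w₃) * T (z₂ - w₄) * (T (z₁ - z₃) * T (z₁ - z₄) * T (z₃ - z₄))) * q2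
    + (T (z₃ - w₃) * T (z₃ - w₄) * (T (z₁ - z₂) * T (z₁ - z₄) * T (z₂ - z₄))) *
      (T (z₃ - (w₁ + w₂ - z₄)) * T (z₃ - z₄)) * a3
    - (T (z₄ - w₃) * T (z₄ - w₄) * (T (z₁ - z₂) * T (z₁ - z₃) * T (z₂ - z₃))) *
      (T (z₃ - (w₁ + w₂ - z₄)) * T (z₃ - z₄)) * a4
    + (e3 * oy - o3 * ey) * T (z₁ - z₄) * T (z₂ - z₄) * T (z₃ - z₄) * t4
    - (e4 * oy - o4 * ey) * T (z₁ - z₃) * T (z₂ - z₃) * T (z₃ - z₄) * t3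

lemma four_term (T E O : ℂ → ℂ) (hd : Differentiable ℂ T) (odd : ∀ x, T (-x) = - T x)
    (hf : ∀ x y, T (x + y) * T (x - y) = E x * O y - O x * E y)
    (z₁ z₂ z₃ z₄ w₁ w₂ w₃ w₄ : ℂ) (h : z₁ + z₂ + z₃ + z₄ = w₁ + w₂ + w₃ + w₄) :
    G4 T z₁ z₂ z₃ z₄ w₁ w₂ w₃ w₄ = 0 := by
  by_cases h0 : ∀ x, T x = 0
  · simp [G4, h0]
  have hne : ∀ c : ℂ, ∀ᶠ s in nhdsWithin (0 : ℂ) {0}ᶜ, T (c + s) ≠ 0 := by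
    intro c
    have hD : Differentiable ℂ (fun s => T (c + s)) := by fun_prop
    have hA : AnalyticOnNhd ℂ (fun s => T (c + s)) Set.univ := fun s _ => hD.analyticAt s
    rcases (hD.analyticAt 0).eventually_eq_zero_or_eventually_ne_zero with h1 | h1
    · exfalso
      apply h0
      intro x
      have h2 := hA.eqOn_zero_of_preconnected_of_eventuallyEq_zero isPreconnected_univ
        (Set.mem_univ 0) h1 (Set.mem_univ (x - c))
      simpa using h2
    · exact h1
  have hc : Continuous T := hd.continuous
  have hG : Continuous (fun s : ℂ => G4 T z₁ z₂ (z₃ + s) z₄ w₁ w₂ w₃ (w₄ + s)) := by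
    unfold G4
    fun_prop
  have l1 : Filter.Tendsto (fun s : ℂ => G4 T z₁ z₂ (z₃ + s) z₄ w₁ w₂ w₃ (w₄ + s))
      (nhdsWithin 0 {0}ᶜ) (nhds (G4 T z₁ z₂ z₃ z₄ w₁ w₂ w₃ w₄)) := by
    have := (hG.tendsto 0).mono_left (nhdsWithin_le_nhds (s := {0}ᶜ))
    simpa using this
  have l2 : Filter.Tendsto (fun s : ℂ => G4 T z₁ z₂ (z₃ + s) z₄ w₁ w₂ w₃ (w₄ + s))
      (nhdsWithin 0 {0}ᶜ) (nhds 0) := by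
    refine tendsto_const_nhds.congr' ?_
    filter_upwards [hne (z₃ + z₄ - w₁ - w₂), hne (z₃ - z₄)] with s h1 h2
    have h3 := four_term_mul T E O odd hf z₁ z₂ (z₃ + s) z₄ w₁ w₂ w₃ (w₄ + s)
      (by linear_combination h)
    rw [show z₃ + s + z₄ - w₁ - w₂ = z₃ + z₄ - w₁ - w₂ + s by ring,
      show z₃ + s - z₄ = z₃ - z₄ + s by ring] at h3
    exact ((mul_eq_zero.1 h3).resolve_left (mul_ne_zero h1 h2)).symm
  exact tendsto_nhds_unique l1 l2

/-- The key theta identity (4.4) in the proof of the adjoint formula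
Δ(a)* = ∓σ∘Δ(∓ā)∘σ, stated with β in place of (N+2)η. -/
theorem key_theta_identity
    (t : ℝ) (ht : 0 < t) (τ : ℂ) (hτ : τ = t * I)
    (u v β : ℂ) (a₁ a₂ a₃ a₄ : ℂ) (ha : a₁ + a₂ + a₃ + a₄ = 0) :
    θf τ (2*v) *
      (Complex.exp (2*cπ*I*β) *
          θf τ (u + v + β + 1/2 + τ/2) * θf τ (u - v + β + 1/2 + τ/2) *
          (θf τ (u + a₁ - β/2) * θf τ (u + a₂ - β/2) *
           θf τ (u + a₃ - β/2) * θf τ (u + a₄ - β/2))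
        - Complex.exp (-(2*cπ*I*β)) *
          θf τ (u + v - β + 1/2 + τ/2) * θf τ (u - v - β + 1/2 + τ/2) *
          (θf τ (u - a₁ + β/2) * θf τ (u - a₂ + β/2) *
           θf τ (u - a₃ + β/2) * θf τ (u - a₄ + β/2)))
    = Complex.exp (cπ*I*(τ - 4*v)) * θf τ (2*u) *
      (Complex.exp (-(2*cπ*I*β)) *
          θf τ (u + v - β + 1/2 + τ/2) * θf τ (u - v + β + 1/2 + τ/2) *
          (θf τ (v + a₁ + 1/2 - τ/2 + β/2) * θf τ (v + a₂ + 1/2 - τ/2 + β/2) *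
           θf τ (v + a₃ + 1/2 - τ/2 + β/2) * θf τ (v + a₄ + 1/2 - τ/2 + β/2))
        - Complex.exp (2*cπ*I*β) *
          θf τ (u + v + β + 1/2 + τ/2) * θf τ (u - v - β + 1/2 + τ/2) *
          (θf τ (v - a₁ + 1/2 - τ/2 - β/2) * θf τ (v - a₂ + 1/2 - τ/2 - β/2) *
           θf τ (v - a₃ + 1/2 - τ/2 - β/2) * θf τ (v - a₄ + 1/2 - τ/2 - β/2))) := by
  have him : 0 < τ.im := by rw [hτ]; simpa using ht
  obtain ⟨y, hy⟩ : ∃ y, y = v + 1/2 - τ/2 := ⟨_, rfl⟩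
  have hG := four_term (θf τ) (Ef τ) (Of τ) (θf_diff τ him) (θf_neg τ) (θf_mul τ him)
    u (-u) (β + y) (β - y) (β/2 - a₁) (β/2 - a₂) (β/2 - a₃) (β/2 - a₄)
    (by linear_combination ha)
  have e1 : ∀ z, θf τ (u + v + z + 1/2 + τ/2) =
      - Complex.exp (-(cπ * I * τ) - 2 * cπ * I * (u + y + z)) * θf τ (u + y + z) := by
    intro z
    rw [← θf_add_tau]
    congr 1
    rw [hy]; ring
  have e2 : ∀ z, θf τ (u - v + z + 1/2 + τ/2) = - θf τ (u - y + z) := by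
    intro z
    rw [← θf_add_one]
    congr 1
    rw [hy]; ring
  have e3 : θf τ (2*v) = Complex.exp (-(cπ * I * τ) - 2 * cπ * I * (2 * y)) * θf τ (2*y) := by
    have h1 := θf_add_one τ (2*v)
    have h2 := θf_add_tau τ (2*y)
    rw [show 2*y + τ = 2*v + 1 by rw [hy]; ring, h1] at h2
    linear_combination -h2
  have e4 : Complex.exp (cπ*I*(τ - 4*v)) = Complex.exp (-(cπ * I * τ) - 2 * cπ * I * (2 * y)) := by
    rw [← mul_one (Complex.exp (-(cπ * I * τ) - _)), ← exp_two_cpi, ← Complex.exp_add]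
    congr 1
    rw [hy]; ring
  have eP : Complex.exp (2*cπ*I*β) * Complex.exp (-(cπ * I * τ) - 2 * cπ * I * (u + y + β)) =
      Complex.exp (-(cπ * I * τ) - 2 * cπ * I * (u + y)) := by
    rw [← Complex.exp_add]; congr 1; ring
  have eM : Complex.exp (-(2*cπ*I*β)) * Complex.exp (-(cπ * I * τ) - 2 * cπ * I * (u + y + -β)) =
      Complex.exp (-(cπ * I * τ) - 2 * cπ * I * (u + y)) := by
    rw [← Complex.exp_add]; congr 1; ring
  have g1 : ∀ a, θf τ (u - (β/2 - a)) = θf τ (u + a - β/2) := fun a => by congr 1; ring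
  have g2 : ∀ a, θf τ (-u - (β/2 - a)) = - θf τ (u - a + β/2) := fun a => by
    rw [← θf_neg]; congr 1; ring
  have g3 : ∀ a, θf τ (β + y - (β/2 - a)) = θf τ (v + a + 1/2 - τ/2 + β/2) := fun a => by
    rw [hy]; congr 1; ring
  have g4 : ∀ a, θf τ (β - y - (β/2 - a)) = - θf τ (v - a + 1/2 - τ/2 - β/2) := fun a => by
    rw [← θf_neg, hy]; congr 1; ring
  have k1 : θf τ (-u - (β + y)) = - θf τ (u + y + β) := by rw [← θf_neg]; congr 1; ring
  have k2 : θf τ (-u - (β - y)) = - θf τ (u - y + β) := by rw [← θf_neg]; congr 1; ring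
  have k3 : θf τ (u - (β + y)) = θf τ (u - y + -β) := by congr 1; ring
  have k4 : θf τ (u - (β - y)) = θf τ (u + y + -β) := by congr 1; ring
  have k5 : θf τ (β + y - (β - y)) = θf τ (2 * y) := by congr 1; ring
  have k6 : θf τ (u - -u) = θf τ (2 * u) := by congr 1; ring
  unfold G4 at hG
  simp only [g1, g2, g3, g4, k1, k2, k3, k4, k5, k6] at hG
  rw [sub_eq_add_neg (u + v) β, sub_eq_add_neg (u - v) β, e1 β, e1 (-β), e2 β, e2 (-β), e3, e4]
  generalize Complex.exp (-(cπ * I * τ) - 2 * cπ * I * (2 * y)) = D at *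
  generalize Complex.exp (-(cπ * I * τ) - 2 * cπ * I * (u + y)) = K at *
  linear_combination D * K * hG
    + (D * θf τ (2*y) * θf τ (u + y + β) * θf τ (u - y + β) *
          (θf τ (u + a₁ - β/2) * θf τ (u + a₂ - β/2) *
           θf τ (u + a₃ - β/2) * θf τ (u + a₄ - β/2))
       + D * θf τ (2*u) * θf τ (u + y + β) * θf τ (u - y + -β) *
          (θf τ (v - a₁ + 1/2 - τ/2 - β/2) * θf τ (v - a₂ + 1/2 - τ/2 - β/2) *
           θf τ (v - a₃ + 1/2 - τ/2 - β/2) * θf τ (v - a₄ + 1/2 - τ/2 - β/2))) * eP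
    - (D * θf τ (2*y) * θf τ (u + y + -β) * θf τ (u - y + -β) *
          (θf τ (u - a₁ + β/2) * θf τ (u - a₂ + β/2) *
           θf τ (u - a₃ + β/2) * θf τ (u - a₄ + β/2))
       + D * θf τ (2*u) * θf τ (u + y + -β) * θf τ (u - y + β) *
          (θf τ (v + a₁ + 1/2 - τ/2 + β/2) * θf τ (v + a₂ + 1/2 - τ/2 + β/2) *
           θf τ (v + a₃ + 1/2 - τ/2 + β/2) * θf τ (v + a₄ + 1/2 - τ/2 + β/2))) * eM
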